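/- arXiv:1207.3136 — 3 statements merged into one kernel-verified Lean document; each statement's English description precedes it below -/
import Mathlib

section
/- Let N be an n × n real matrix and σ ≥ 1 with N^σ = 0, let B be n × j and F be n × p real matrices satisfying N^i B = 0 and N^i F = 0 for every integer 1 ≤ i < σ, and let u : ℕ → ℝʲ, w : ℕ → ℝᵖ. If x : ℕ → ℝⁿ satisfies N x_{k+1} = x_k + B u_k + F w_k for every k ≥ 0, then x_k = −B u_k − F w_k for every k ≥ 0; that is, the state at time k depends only on the input and disturbance at time k, so the subsystem is causal even if the nilpotency degree σ exceeds 1. -/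
open Matrix

/-- Let `N` be an `n × n` real matrix with `N^σ = 0` for some `σ ≥ 1`, and let `B`, `F` be
matrices with `N^i B = 0` and `N^i F = 0` for every `1 ≤ i < σ`.  If `x` satisfies
`N x_{k+1} = x_k + B u_k + F w_k` for every `k`, then `x_k = -B u_k - F w_k` for every `k`:
the subsystem is causal even if the nilpotency degree `σ` exceeds `1`. -/
theorem nilpotent_subsystem_causal (n j p σ : ℕ) (hσ : 1 ≤ σ)
    (N : Matrix (Fin n) (Fin n) ℝ) (hN : N ^ σ = 0)
    (B : Matrix (Fin n) (Fin j) ℝ) (F : Matrix (Fin n) (Fin p) ℝ)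
    (hB : ∀ i : ℕ, 1 ≤ i → i < σ → (N ^ i) * B = 0)
    (hF : ∀ i : ℕ, 1 ≤ i → i < σ → (N ^ i) * F = 0)
    (u : ℕ → Fin j → ℝ) (w : ℕ → Fin p → ℝ) (x : ℕ → Fin n → ℝ)
    (hrec : ∀ k : ℕ, N.mulVec (x (k + 1)) = x k + B.mulVec (u k) + F.mulVec (w k)) :
    ∀ k : ℕ, x k = -B.mulVec (u k) - F.mulVec (w k) := by
  have annihilates : ∀ {q : ℕ} (M : Matrix (Fin n) (Fin q) ℝ),
      (∀ i : ℕ, 1 ≤ i → i < σ → N ^ i * M = 0) → N * M = 0 := by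
    intro q M hM
    rcases hσ.eq_or_lt with h | h
    · subst h
      rw [pow_one] at hN
      rw [hN, Matrix.zero_mul]
    · simpa using hM 1 le_rfl h
  have hNB := annihilates B hB
  have hNF := annihilates F hF
  have shift : ∀ m k : ℕ, N *ᵥ x k = N ^ (m + 1) *ᵥ x (k + m) := by
    intro m
    induction m with
    | zero => simp
    | succ m ih =>
      intro k
      rw [ih k, pow_succ N (m + 1), ← mulVec_mulVec, ← add_assoc, hrec, mulVec_add, mulVec_add,
        mulVec_mulVec, mulVec_mulVec, pow_succ, Matrix.mul_assoc _ N B, Matrix.mul_assoc _ N F,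
        hNB, hNF]
      simp
  intro k
  have hx : N *ᵥ x (k + 1) = 0 := by
    rw [shift σ, pow_succ, hN, Matrix.zero_mul, zero_mulVec]
  rw [hrec, add_assoc] at hx
  rw [eq_neg_of_add_eq_zero_left hx, neg_add']
end

section
/- Let E, A ∈ ℝ^{n_eq × n}, B ∈ ℝ^{n_eq × j}, H ∈ ℝ^{m × n}, let R ∈ ℝ^{m × m} and P₀ ∈ ℝ^{n_eq × n_eq} be positive definite, let F ∈ ℝ^{n_eq × p} be such that Q := F Fᵀ is positive definite, let P ∈ ℝ^{n_eq × n_eq} be invertible, and fix a horizon T ≥ 0, sequences u_0,…,u_{T−1} ∈ ℝʲ, y_0,…,y_T ∈ ℝᵐ and r̄₀ ∈ ℝ^{n_eq}. Then for every state sequence x_0,…,x_T ∈ ℝⁿ the transformed MAP objective equals the untransformed one: (1/2)‖P E x₀ − P r̄₀‖²_{P P₀ Pᵀ} + (1/2) Σ_{k=0}^{T} ‖y_k − H x_k‖²_R + (1/2) Σ_{k=0}^{T−1} ‖P E x_{k+1} − P A x_k − P B u_k‖²_{P Q Pᵀ} = (1/2)‖E x₀ − r̄₀‖²_{P₀} +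 (1/2) Σ_{k=0}^{T} ‖y_k − H x_k‖²_R + (1/2) Σ_{k=0}^{T−1} ‖E x_{k+1} − A x_k − B u_k‖²_{Q}. Consequently the MAP estimate for a causal index-1 descriptor system can be computed directly from the original system matrices, with no model transformation. -/
open Matrix

/-- For a positive definite matrix `M`, the weighted squared norm of a vector `v` is
`‖v‖²_M := vᵀ M⁻¹ v` (the Mahalanobis quadratic form with weight matrix `M⁻¹`). -/
noncomputable def wnormSq {ι : Type*} [Fintype ι] [DecidableEq ι]
    (M : Matrix ι ι ℝ) (v : ι → ℝ) : ℝ :=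
  v ⬝ᵥ M⁻¹.mulVec v

/-- The weighted squared norm is invariant under a simultaneous invertible change of coordinates
of the vector and congruence of the weight. -/
theorem wnormSq_congruence {ι : Type*} [Fintype ι] [DecidableEq ι]
    {P : Matrix ι ι ℝ} (hP : IsUnit P) (M : Matrix ι ι ℝ) (v : ι → ℝ) :
    wnormSq (P * M * Pᵀ) (P *ᵥ v) = wnormSq M v := by
  have hdet : IsUnit P.det := (isUnit_iff_isUnit_det P).mp hP
  have hdetT : IsUnit Pᵀ.det := by rwa [det_transpose]
  have hcancel : Pᵀ * ((P * M * Pᵀ)⁻¹ * P) = M⁻¹ := by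
    rw [Matrix.mul_inv_rev, Matrix.mul_inv_rev, Matrix.mul_assoc, Matrix.mul_assoc,
      nonsing_inv_mul P hdet, Matrix.mul_one, mul_nonsing_inv_cancel_left _ _ hdetT]
  unfold wnormSq
  rw [mulVec_mulVec, dotProduct_comm, dotProduct_mulVec, ← mulVec_transpose, mulVec_mulVec,
    hcancel, dotProduct_comm]

/-- The MAP objective for a causal index-1 descriptor system is invariant under left
multiplication of the system by an invertible matrix `P`:
`(1/2)‖P E x₀ - P r̄₀‖²_{P P₀ Pᵀ} + (1/2)∑ₖ ‖y_k - H x_k‖²_R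
  + (1/2)∑ₖ ‖P E x_{k+1} - P A x_k - P B u_k‖²_{P Q Pᵀ}`
equals
`(1/2)‖E x₀ - r̄₀‖²_{P₀} + (1/2)∑ₖ ‖y_k - H x_k‖²_R
  + (1/2)∑ₖ ‖E x_{k+1} - A x_k - B u_k‖²_Q`,
where `Q = F Fᵀ`.  Hence the MAP estimate can be computed directly from the original
system matrices, with no model transformation. -/
theorem map_objective_transformation_invariance
    (neq n j p m T : ℕ)
    (E A : Matrix (Fin neq) (Fin n) ℝ) (B : Matrix (Fin neq) (Fin j) ℝ)
    (H : Matrix (Fin m) (Fin n) ℝ)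
    (R : Matrix (Fin m) (Fin m) ℝ) (hR : R.PosDef)
    (P₀ : Matrix (Fin neq) (Fin neq) ℝ) (hP₀ : P₀.PosDef)
    (F : Matrix (Fin neq) (Fin p) ℝ) (hF : (F * Fᵀ).PosDef)
    (P : Matrix (Fin neq) (Fin neq) ℝ) (hP : IsUnit P)
    (u : ℕ → Fin j → ℝ) (y : ℕ → Fin m → ℝ) (r₀ : Fin neq → ℝ)
    (x : ℕ → Fin n → ℝ) :
    (1 / 2 : ℝ) * wnormSq (P * P₀ * Pᵀ) (P.mulVec (E.mulVec (x 0)) - P.mulVec r₀)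
      + (1 / 2 : ℝ) * ∑ k ∈ Finset.range (T + 1), wnormSq R (y k - H.mulVec (x k))
      + (1 / 2 : ℝ) * ∑ k ∈ Finset.range T,
          wnormSq (P * (F * Fᵀ) * Pᵀ)
            (P.mulVec (E.mulVec (x (k + 1))) - P.mulVec (A.mulVec (x k))
              - P.mulVec (B.mulVec (u k)))
    = (1 / 2 : ℝ) * wnormSq P₀ (E.mulVec (x 0) - r₀)
      + (1 / 2 : ℝ) * ∑ k ∈ Finset.range (T + 1), wnormSq R (y k - H.mulVec (x k))
      + (1 / 2 : ℝ) * ∑ k ∈ Finset.range T,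
          wnormSq (F * Fᵀ)
            (E.mulVec (x (k + 1)) - A.mulVec (x k) - B.mulVec (u k)) := by
  simp only [← mulVec_sub, wnormSq_congruence hP]
end

section
/- (Weierstrass canonical form; regular-pencil case of the Kronecker canonical form) Let E, A ∈ ℝ^{n × n} be such that the pencil is regular, i.e. there exists λ₀ ∈ ℝ with det(λ₀ E − A) ≠ 0. Then there exist invertible real matrices P, Q ∈ ℝ^{n × n}, a decomposition n = n₁ + n₂, a matrix J ∈ ℝ^{n₁ × n₁}, and a nilpotent matrix N ∈ ℝ^{n₂ × n₂}, such that P E Q is the block diagonal matrix diag(I_{n₁}, N) and P A Q is the block diagonal matrix diag(J, I_{n₂}). -/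
open Matrix

open Module in
/-- Fitting decomposition: an endomorphism of a finite-dimensional space is conjugate to the
product of a bijective and a nilpotent endomorphism. -/
theorem LinearMap.exists_fitting_decomposition {K V : Type*} [Field K] [AddCommGroup V]
    [Module K V] [FiniteDimensional K V] (f : End K V) :
    ∃ (p q : Submodule K V) (e : (p × q) ≃ₗ[K] V) (u : End K p) (v : End K q),
      IsUnit u ∧ IsNilpotent v ∧ f ∘ₗ e.toLinearMap = e.toLinearMap ∘ₗ u.prodMap v := by
  obtain ⟨k, hk, hk1⟩ :=
    (f.eventually_isCompl_ker_pow_range_pow.and (Filter.eventually_ge_atTop 1)).exists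
  have hp : ∀ x ∈ range (f ^ k), f x ∈ range (f ^ k) := by
    rintro _ ⟨y, rfl⟩
    exact ⟨f y, by rw [← Module.End.mul_apply, ← Module.End.mul_apply, ← pow_succ, pow_succ']⟩
  have hq : ∀ x ∈ ker (f ^ k), f x ∈ ker (f ^ k) := by
    intro x hx
    rw [mem_ker] at hx ⊢
    rw [← Module.End.mul_apply, ← pow_succ, pow_succ', Module.End.mul_apply, hx, map_zero]
  refine ⟨range (f ^ k), ker (f ^ k), Submodule.prodEquivOfIsCompl _ _ hk.symm,
    f.restrict hp, f.restrict hq, ?_, ⟨k, ?_⟩, ?_⟩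
  · rw [LinearMap.isUnit_iff_ker_eq_bot, ker_eq_bot']
    intro x hx
    have hfx : f x = 0 := congrArg Subtype.val hx
    have hker : (x : V) ∈ ker (f ^ k) :=
      Module.End.pow_map_zero_of_le hk1 (by rwa [pow_one])
    exact Subtype.ext (Submodule.disjoint_def.mp hk.disjoint _ hker x.2)
  · rw [Module.End.pow_restrict]
    ext x
    exact x.2
  · ext x <;> simp

open Module in
/-- Matrix form of the Fitting decomposition: a square matrix over a field is similar to a block
diagonal matrix with an invertible and a nilpotent block. -/
theorem Matrix.exists_fitting_decomposition {K : Type*} [Field K] {n : ℕ}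
    (M : Matrix (Fin n) (Fin n) K) :
    ∃ (n₁ n₂ : ℕ) (h : n₁ + n₂ = n) (T : Matrix (Fin n) (Fin n) K)
      (C : Matrix (Fin n₁) (Fin n₁) K) (N : Matrix (Fin n₂) (Fin n₂) K),
      IsUnit T ∧ IsUnit C ∧ IsNilpotent N ∧
        M * T = T * reindex (finSumFinEquiv.trans (finCongr h))
          (finSumFinEquiv.trans (finCongr h)) (fromBlocks C 0 0 N) := by
  obtain ⟨p, q, e, u, v, hu, hv, he⟩ := (toLin' M).exists_fitting_decomposition
  have h : finrank K p + finrank K q = n := by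
    rw [← finrank_prod, e.finrank_eq, finrank_fin_fun]
  let bp := finBasis K p
  let bq := finBasis K q
  let b := (bp.prod bq).map e
  let ε := finSumFinEquiv.trans (finCongr h)
  let b' := b.reindex ε
  let s := Pi.basisFun K (Fin n)
  refine ⟨_, _, h, s.toMatrix b', LinearMap.toMatrix bp bp u, LinearMap.toMatrix bq bq v,
    ?_, ?_, ?_, ?_⟩
  · exact IsUnit.of_mul_eq_one _ (s.toMatrix_mul_toMatrix_flip b')
  · exact hu.map (LinearMap.toMatrixAlgEquiv bp)
  · exact (LinearMap.isNilpotent_toMatrix_iff bq v).mpr hv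
  · have hM : LinearMap.toMatrix s s (toLin' M) = M := LinearMap.toMatrix'_toLin' M
    have hblock : LinearMap.toMatrix b' b' (toLin' M) = reindex ε ε
        (fromBlocks (LinearMap.toMatrix bp bp u) 0 0 (LinearMap.toMatrix bq bq v)) := by
      rw [← LinearMap.toMatrix_prodMap]
      ext i j
      have hj := LinearMap.congr_fun he ((bp.prod bq) (ε.symm j))
      simp only [LinearMap.comp_apply, LinearEquiv.coe_coe] at hj
      simp only [b', b, LinearMap.toMatrix_apply, Basis.reindex_apply, Basis.map_apply,
        Basis.repr_reindex_apply, Basis.map_repr, LinearEquiv.trans_apply, hj,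
        LinearEquiv.symm_apply_apply, reindex_apply, submatrix_apply]
    rw [← hblock, basis_toMatrix_mul_linearMap_toMatrix,
      ← linearMap_toMatrix_mul_basis_toMatrix b' s s, hM]

/-- Weierstrass canonical form (regular-pencil case of the Kronecker canonical form):
if the pencil `λ E - A` with `E, A ∈ ℝ^{n×n}` is regular (there is `λ₀` with
`det (λ₀ E - A) ≠ 0`), then there are invertible `P, Q`, a decomposition `n = n₁ + n₂`,
a matrix `J` of size `n₁` and a nilpotent matrix `N` of size `n₂` such that
`P E Q = diag(I_{n₁}, N)` and `P A Q = diag(J, I_{n₂})`. -/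
theorem weierstrass_canonical_form
    (n : ℕ) (E A : Matrix (Fin n) (Fin n) ℝ)
    (hreg : ∃ l₀ : ℝ, (l₀ • E - A).det ≠ 0) :
    ∃ (n₁ n₂ : ℕ) (h : n₁ + n₂ = n)
      (P Q : Matrix (Fin n) (Fin n) ℝ), IsUnit P ∧ IsUnit Q ∧
      ∃ (J : Matrix (Fin n₁) (Fin n₁) ℝ) (N : Matrix (Fin n₂) (Fin n₂) ℝ),
        IsNilpotent N ∧
        P * E * Q = Matrix.reindex (finSumFinEquiv.trans (finCongr h))
          (finSumFinEquiv.trans (finCongr h)) (Matrix.fromBlocks 1 0 0 N) ∧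
        P * A * Q = Matrix.reindex (finSumFinEquiv.trans (finCongr h))
          (finSumFinEquiv.trans (finCongr h)) (Matrix.fromBlocks J 0 0 1) := by
  obtain ⟨l₀, hl₀⟩ := hreg
  have hS : IsUnit (l₀ • E - A) := (isUnit_iff_isUnit_det _).mpr hl₀.isUnit
  obtain ⟨S, hS⟩ := hS
  obtain ⟨n₁, n₂, h, T, C, N, ⟨T, rfl⟩, ⟨C, rfl⟩, hN, hT⟩ :=
    exists_fitting_decomposition ((↑S⁻¹ : Matrix (Fin n) (Fin n) ℝ) * E)
  obtain ⟨B, hB⟩ : IsUnit (l₀ • N - 1) := (hN.smul l₀).isUnit_sub_one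
  have hcomm : Commute (↑B⁻¹ : Matrix (Fin n₂) (Fin n₂) ℝ) N := by
    refine Commute.units_inv_left ?_
    rw [hB]
    exact ((Commute.refl N).smul_left l₀).sub_left (Commute.one_left N)
  let R := reindexAlgEquiv ℝ ℝ (finSumFinEquiv.trans (finCongr h))
  change _ = _ * R (fromBlocks _ 0 0 N) at hT
  have hD : IsUnit (fromBlocks (↑C⁻¹ : Matrix (Fin n₁) (Fin n₁) ℝ) 0 0
      (↑B⁻¹ : Matrix (Fin n₂) (Fin n₂) ℝ)) := by
    refine IsUnit.of_mul_eq_one (fromBlocks ↑C 0 0 ↑B) ?_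
    simp [fromBlocks_multiply]
  have hE : ((T⁻¹).val * (S⁻¹).val) * E * T = R (fromBlocks C 0 0 N) := by
    rw [mul_assoc (↑T⁻¹ : Matrix (Fin n) (Fin n) ℝ), mul_assoc, hT, Units.inv_mul_cancel_left]
  have hA : ((T⁻¹).val * (S⁻¹).val) * A * T =
      R (fromBlocks (l₀ • ↑C - 1) 0 0 B) := by
    have hAE : A = l₀ • E - S := by rw [hS, sub_sub_cancel]
    have hone : ((T⁻¹).val * (S⁻¹).val) * S * T = 1 := by
      rw [Units.inv_mul_cancel_right, Units.inv_mul]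
    rw [hAE, mul_sub, sub_mul, hone, mul_smul_comm, smul_mul_assoc, hE, ← map_smul, ← map_one R,
      ← map_sub, hB, ← fromBlocks_one, fromBlocks_smul,
      sub_eq_add_neg, fromBlocks_neg, fromBlocks_add]
    simp [sub_eq_add_neg]
  refine ⟨n₁, n₂, h, R (fromBlocks ↑C⁻¹ 0 0 ↑B⁻¹) * ((T⁻¹).val * (S⁻¹).val), T,
    (hD.map R).mul (T⁻¹.isUnit.mul S⁻¹.isUnit), T.isUnit, (C⁻¹).val * (l₀ • ↑C - 1), (B⁻¹).val * N,
    hcomm.isNilpotent_mul_left hN, ?_, ?_⟩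
  · rw [mul_assoc _ _ E, mul_assoc _ _ (T : Matrix (Fin n) (Fin n) ℝ), hE, ← map_mul,
      fromBlocks_multiply]
    simp [R]
  · rw [mul_assoc _ _ A, mul_assoc _ _ (T : Matrix (Fin n) (Fin n) ℝ), hA, ← map_mul,
      fromBlocks_multiply]
    simp [R]
end
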